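/- Let μ be a Borel measure on U := ℝ_+^d \ {0} such that ∫_U ‖z‖ (1+log ‖z‖) 1_{{‖z‖ ≥ 1}} μ(dz) < ∞ and ∫_U ‖z‖² 1_{{‖z‖ < 1}} μ(dz) < ∞, and let s > 0. Then ∫₀^∞ ∫_U u e^{−su} ‖z‖² 1_{{‖z‖ < e^{su}}} μ(dz) du < ∞. -/

import Mathlib

open MeasureTheory

lemma aux_int (s : ℝ) (hs : 0 < s) (a : ℝ) (ha : 0 ≤ a) :
    ∫⁻ u in Set.Ioi a, ENNReal.ofReal (u * Real.exp (-s * u))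
      = ENNReal.ofReal (Real.exp (-s * a) * (s * a + 1) / s ^ 2) := by
  have hd : ∀ x ∈ Set.Ici a, HasDerivAt
      (fun u : ℝ => -(((s * u) ^ 1 * Real.exp (-(s * u)) + (s * u) ^ 0 * Real.exp (-(s * u))) / s ^ 2))
      (x * Real.exp (-s * x)) x := by
    intro x _
    have h0 : HasDerivAt (fun u : ℝ => s * u) s x := by
      simpa using (hasDerivAt_id x).const_mul s
    have he := h0.neg.exp
    have := (((h0.mul he).add he).div_const (s ^ 2)).neg
    simp only [pow_one, pow_zero, one_mul]
    refine this.congr_deriv ?_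
    rw [neg_mul]
    simp only [Pi.neg_apply]
    field_simp
    ring
  have hnn : ∀ x ∈ Set.Ioi a, 0 ≤ x * Real.exp (-s * x) := fun x hx =>
    mul_nonneg (ha.trans (le_of_lt hx)) (Real.exp_pos _).le
  have hsu : Filter.Tendsto (fun u : ℝ => s * u) Filter.atTop Filter.atTop :=
    Filter.tendsto_id.const_mul_atTop hs
  have ht : Filter.Tendsto
      (fun u : ℝ => -(((s * u) ^ 1 * Real.exp (-(s * u)) + (s * u) ^ 0 * Real.exp (-(s * u))) / s ^ 2))
      Filter.atTop (nhds 0) := by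
    have h1 := (Real.tendsto_pow_mul_exp_neg_atTop_nhds_zero 1).comp hsu
    have h0 := (Real.tendsto_pow_mul_exp_neg_atTop_nhds_zero 0).comp hsu
    simpa using ((h1.add h0).div_const (s ^ 2)).neg
  rw [← ofReal_integral_eq_lintegral_ofReal (integrableOn_Ioi_deriv_of_nonneg' hd hnn ht)
    ((ae_restrict_iff' measurableSet_Ioi).2 (Filter.Eventually.of_forall hnn)),
    integral_Ioi_of_hasDerivAt_of_nonneg' hd hnn ht]
  congr 1
  rw [neg_mul]
  ring

lemma aux_bound (s : ℝ) (hs : 0 < s) (r : ℝ) (hr : 0 ≤ r) :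
    ∫⁻ u in Set.Ioi (0 : ℝ), ENNReal.ofReal
        (if r < Real.exp (s * u) then u * Real.exp (-s * u) * r ^ 2 else 0)
      ≤ ENNReal.ofReal (1 / s ^ 2) * (ENNReal.ofReal (if 1 ≤ r then r * (1 + Real.log r) else 0)
        + ENNReal.ofReal (if r < 1 then r ^ 2 else 0)) := by
  have key : ∀ a : ℝ, 0 ≤ a → (∀ u, 0 < u → r < Real.exp (s * u) → a < u) →
      ∫⁻ u in Set.Ioi (0 : ℝ), ENNReal.ofReal
        (if r < Real.exp (s * u) then u * Real.exp (-s * u) * r ^ 2 else 0)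
      ≤ ENNReal.ofReal (Real.exp (-s * a) * (s * a + 1) / s ^ 2) * ENNReal.ofReal (r ^ 2) := by
    intro a ha h
    rw [← aux_int s hs a ha, ← lintegral_mul_const' _ _ ENNReal.ofReal_ne_top,
      ← lintegral_indicator measurableSet_Ioi, ← lintegral_indicator measurableSet_Ioi]
    refine lintegral_mono fun u => ?_
    by_cases hu : 0 < u
    · rw [Set.indicator_of_mem (by exact hu)]
      split_ifs with hru
      · rw [Set.indicator_of_mem (by exact h u hu hru), ENNReal.ofReal_mul]
        exact mul_nonneg hu.le (Real.exp_pos _).le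
      · simp
    · rw [Set.indicator_of_notMem (by exact hu)]
      simp
  rcases lt_or_ge r 1 with h | h
  · refine (key 0 le_rfl fun u hu _ => hu).trans ?_
    simp [h, not_le.2 h]
  · have hl := Real.log_nonneg h
    have hr0 : 0 < r := by linarith
    refine (key (Real.log r / s) (by positivity) fun u hu hru => ?_).trans ?_
    · rw [div_lt_iff₀ hs, mul_comm u]
      exact (Real.log_lt_iff_lt_exp hr0).2 hru
    · rw [if_pos h, if_neg (not_lt.2 h), ENNReal.ofReal_zero, add_zero,
        ← ENNReal.ofReal_mul (by positivity), ← ENNReal.ofReal_mul (by positivity)]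
      apply ENNReal.ofReal_le_ofReal
      have e : -s * (Real.log r / s) = - Real.log r := by field_simp
      have e2 : s * (Real.log r / s) = Real.log r := by field_simp
      rw [e, e2, Real.exp_neg, Real.exp_log hr0]
      apply le_of_eq
      field_simp
      ring



/-- If a Borel measure `μ` on `U = ℝ_+^d \ {0}` satisfies
`∫ ‖z‖(1+log‖z‖) 1_{‖z‖≥1} μ(dz) < ∞` and `∫ ‖z‖² 1_{‖z‖<1} μ(dz) < ∞`, and `s > 0`, then
`∫₀^∞ ∫ u e^{-su} ‖z‖² 1_{‖z‖<e^{su}} μ(dz) du < ∞`. -/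
theorem stmt7 {d : ℕ} (μ : Measure (EuclideanSpace ℝ (Fin d)))
    (hsupp : μ {z : EuclideanSpace ℝ (Fin d) | ¬ ((∀ i, 0 ≤ z i) ∧ z ≠ 0)} = 0)
    (s : ℝ) (hs : 0 < s)
    (h1 : ∫⁻ z, ENNReal.ofReal
        (if 1 ≤ ‖z‖ then ‖z‖ * (1 + Real.log ‖z‖) else 0) ∂μ < ⊤)
    (h2 : ∫⁻ z, ENNReal.ofReal (if ‖z‖ < 1 then ‖z‖ ^ 2 else 0) ∂μ < ⊤) :
    ∫⁻ u in Set.Ioi (0 : ℝ), ∫⁻ z, ENNReal.ofReal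
        (if ‖z‖ < Real.exp (s * u) then u * Real.exp (-s * u) * ‖z‖ ^ 2 else 0) ∂μ < ⊤ := by

  set g : EuclideanSpace ℝ (Fin d) → ENNReal := fun z =>
    ENNReal.ofReal (if 1 ≤ ‖z‖ then ‖z‖ * (1 + Real.log ‖z‖) else 0)
      + ENNReal.ofReal (if ‖z‖ < 1 then ‖z‖ ^ 2 else 0) with hg
  have m1 : Measurable fun z : EuclideanSpace ℝ (Fin d) =>
      ENNReal.ofReal (if 1 ≤ ‖z‖ then ‖z‖ * (1 + Real.log ‖z‖) else 0) := by
    refine ENNReal.measurable_ofReal.comp (Measurable.ite ?_ ?_ measurable_const)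
    · exact measurableSet_le measurable_const measurable_norm
    · exact measurable_norm.mul (measurable_const.add (Real.measurable_log.comp measurable_norm))
  have m2 : Measurable fun z : EuclideanSpace ℝ (Fin d) =>
      ENNReal.ofReal (if ‖z‖ < 1 then ‖z‖ ^ 2 else 0) := by
    refine ENNReal.measurable_ofReal.comp (Measurable.ite ?_ ?_ measurable_const)
    · exact measurableSet_lt measurable_norm measurable_const
    · exact measurable_norm.pow_const 2
  have mg : Measurable g := m1.add m2
  have gfin : ∫⁻ z, g z ∂μ < ⊤ := by
    rw [hg, lintegral_add_left m1]
    exact ENNReal.add_lt_top.2 ⟨h1, h2⟩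
  have gne : ∀ᵐ z ∂μ, g z ≠ 0 := by
    refine measure_mono_null ?_ hsupp
    intro z hz hz2
    apply hz
    have hp : 0 < ‖z‖ := norm_pos_iff.2 hz2.2
    rcases lt_or_ge ‖z‖ 1 with h | h
    · simp [hg, h, not_le.2 h, hz2.2]
    · have := Real.log_nonneg h
      have h3 : 0 < ‖z‖ * (1 + Real.log ‖z‖) := by positivity
      simp only [hg, ne_eq, add_eq_zero, ENNReal.ofReal_eq_zero, not_and]
      intro h4
      rw [if_pos h] at h4
      linarith
  have gtop : ∀ᵐ z ∂μ, g z ≠ ⊤ := Filter.Eventually.of_forall fun z => by simp [hg]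
  have : SFinite μ := by
    have : IsFiniteMeasure (μ.withDensity g) := isFiniteMeasure_withDensity gfin.ne
    rw [← withDensity_inv_same₀ mg.aemeasurable gne gtop]
    infer_instance
  rw [lintegral_lintegral_swap]
  · refine (lintegral_mono fun z => aux_bound s hs ‖z‖ (norm_nonneg z)).trans_lt ?_
    rw [lintegral_const_mul' _ _ ENNReal.ofReal_ne_top]
    exact ENNReal.mul_lt_top ENNReal.ofReal_lt_top gfin
  · refine Measurable.aemeasurable ?_
    refine ENNReal.measurable_ofReal.comp (Measurable.ite ?_ ?_ measurable_const)
    · exact measurableSet_lt (by fun_prop) (by fun_prop)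
    · fun_prop
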